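/- (Loss bound.) In non-stationary approximate MPI with parameters m ≥ 0 and ℓ ≥ 1 on a finite MDP, for every k ≥ 1 the loss satisfies, in the Γ-notation, l_k ≤ ∑_{i=1}^{k−1} Γ^{i} ( ∑_{j=0}^{∞} Γ^{ℓj} (I − Γ^ℓ) − I ) ε_{k−i} + η_k, where η_k = ∑_{i=0}^{∞} Γ^{ℓi + k − 1} b_0 + Γ^k d_0 (each occurrence of Γ^n standing for some element of 𝕡_n, the infinite sums converging absolutely). -/

import Mathlib

structure MDP (X A : Type) [Fintype X] [Fintype A] where
  P : X → A → X → ℝ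
  r : X → A → ℝ
  γ : ℝ
  P_nonneg : ∀ x a y, 0 ≤ P x a y
  P_sum : ∀ x a, ∑ y, P x a y = 1
  γ_pos : 0 < γ
  γ_lt_one : γ < 1

namespace MDP

variable {X A : Type} [Fintype X] [Fintype A]

/-- Bellman operator of a stationary policy. -/
noncomputable def T (M : MDP X A) (π : X → A) (v : X → ℝ) : X → ℝ :=
  fun x => M.r x (π x) + M.γ * ∑ y, M.P x (π x) y * v y

/-- Action-value function. -/
noncomputable def Q (M : MDP X A) (v : X → ℝ) (x : X) (a : A) : ℝ :=
  M.r x a + M.γ * ∑ y, M.P x a y * v y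

/-- `π` is greedy with respect to `v` (action form). -/
def IsGreedy (M : MDP X A) (π : X → A) (v : X → ℝ) : Prop :=
  ∀ x, M.T π v x = ⨆ a : A, M.Q v x a

/-- `π` is greedy with respect to `v` (componentwise max over policies form). -/
def IsGreedyPol (M : MDP X A) (π : X → A) (v : X → ℝ) : Prop :=
  ∀ x, M.T π v x = ⨆ π' : X → A, M.T π' v x

/-- Composed Bellman operator `T_{π_k} T_{π_{k-1}} ⋯ T_{π_{k-n+1}}`. -/
noncomputable def Tcomp (M : MDP X A) (π : ℤ → X → A) : ℕ → ℤ → (X → ℝ) → (X → ℝ)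
  | 0, _ => id
  | (n+1), k => fun v => M.T (π k) (M.Tcomp π n (k-1) v)

/-- Transition kernel of a stationary policy, as a matrix. -/
def Pmat (M : MDP X A) (π : X → A) : Matrix X X ℝ :=
  Matrix.of fun x y => M.P x (π x) y

/-- Composed kernel `P_{π_k} P_{π_{k-1}} ⋯ P_{π_{k-n+1}}`. -/
noncomputable def Pcomp (M : MDP X A) [DecidableEq X] (π : ℤ → X → A) : ℕ → ℤ → Matrix X X ℝ
  | 0, _ => 1
  | (n+1), k => M.Pmat (π k) * M.Pcomp π n (k-1)

/-- `n`-fold products `(γ P_{π_1}) ⋯ (γ P_{π_n})`. -/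
def prodSet (M : MDP X A) [DecidableEq X] : ℕ → Set (Matrix X X ℝ)
  | 0 => {1}
  | (n+1) => {Q | ∃ (π : X → A) (Q' : Matrix X X ℝ), Q' ∈ M.prodSet n ∧ Q = (M.γ • M.Pmat π) * Q'}

/-- `𝕡_n`: convex combinations of `n`-fold products of discounted kernels. -/
noncomputable def Gamma (M : MDP X A) [DecidableEq X] (n : ℕ) : Set (Matrix X X ℝ) :=
  convexHull ℝ (M.prodSet n)

end MDP

/-- Residual `b_k = T_{π_{k+1}} v_k − T_{π_{k+1},ℓ} T_{π_{k+1}} v_k`. -/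
noncomputable def bres {X A : Type} [Fintype X] [Fintype A] (M : MDP X A) (π : ℤ → X → A) (ℓ : ℕ)
    (v : ℕ → X → ℝ) (k : ℕ) : X → ℝ :=
  fun x => M.T (π ((k : ℤ) + 1)) (v k) x
    - M.Tcomp π ℓ ((k : ℤ) + 1) (M.T (π ((k : ℤ) + 1)) (v k)) x

/-- Distance `d_k = v_* − v_k + ε_k`. -/
noncomputable def dres {X : Type} (vstar : X → ℝ) (v err : ℕ → X → ℝ) (k : ℕ) : X → ℝ :=
  fun x => vstar x - v k x + err k x

open Matrix in
theorem MDP.T_sub_aux {X A : Type} [Fintype X] [Fintype A] (M : MDP X A) (p : X → A)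
    (u w : X → ℝ) : M.T p u - M.T p w = (M.γ • M.Pmat p) *ᵥ (u - w) := by
  funext x
  simp only [MDP.T, Pi.sub_apply, Matrix.mulVec, dotProduct, Matrix.smul_apply, MDP.Pmat,
    Matrix.of_apply, smul_eq_mul]
  rw [add_sub_add_left_eq_sub, ← mul_sub, ← Finset.sum_sub_distrib, Finset.mul_sum]
  refine Finset.sum_congr rfl fun y _ => by ring

theorem MDP.prodSet_one_aux {X A : Type} [Fintype X] [Fintype A] [DecidableEq X] (M : MDP X A)
    (p : X → A) : (M.γ • M.Pmat p) ∈ M.prodSet 1 :=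
  ⟨p, 1, rfl, by simp⟩

theorem MDP.prodSet_mul_aux {X A : Type} [Fintype X] [Fintype A] [DecidableEq X] (M : MDP X A)
    {b : ℕ} {K : Matrix X X ℝ} (hK : K ∈ M.prodSet b) :
    ∀ (a : ℕ) (L : Matrix X X ℝ), L ∈ M.prodSet a → L * K ∈ M.prodSet (a + b) := by
  intro a
  induction a with
  | zero =>
    intro L hL
    have : L = 1 := hL
    subst this
    simpa using hK
  | succ n ih =>
    rintro L ⟨p, Q', hQ', rfl⟩
    rw [show n + 1 + b = (n + b) + 1 by ring]
    exact ⟨p, Q' * K, ih _ hQ', by rw [Matrix.mul_assoc]⟩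

theorem MDP.prodSet_pow_aux {X A : Type} [Fintype X] [Fintype A] [DecidableEq X] (M : MDP X A)
    {b : ℕ} {K : Matrix X X ℝ} (hK : K ∈ M.prodSet b) (j : ℕ) : K ^ j ∈ M.prodSet (b * j) := by
  induction j with
  | zero => simp [MDP.prodSet]
  | succ n ih =>
    rw [pow_succ, Nat.mul_succ]
    exact M.prodSet_mul_aux hK _ _ ih

open Matrix in
theorem MDP.prodSet_mono_aux {X A : Type} [Fintype X] [Fintype A] [DecidableEq X] (M : MDP X A) :
    ∀ (n : ℕ) (L : Matrix X X ℝ), L ∈ M.prodSet n → ∀ u w : X → ℝ, (∀ x, u x ≤ w x) →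
      ∀ x, (L *ᵥ u) x ≤ (L *ᵥ w) x := by
  intro n
  induction n with
  | zero =>
    intro L hL u w h x
    have : L = 1 := hL
    subst this
    simpa using h x
  | succ n ih =>
    rintro L ⟨p, Q', hQ', rfl⟩ u w h x
    rw [← Matrix.mulVec_mulVec, ← Matrix.mulVec_mulVec]
    have h2 := ih Q' hQ' u w h
    simp only [Matrix.mulVec, dotProduct, Matrix.smul_apply, MDP.Pmat,
      Matrix.of_apply, smul_eq_mul] at h2 ⊢
    refine Finset.sum_le_sum fun y _ => mul_le_mul_of_nonneg_left (h2 y) ?_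
    exact mul_nonneg M.γ_pos.le (M.P_nonneg _ _ _)

open Matrix in
theorem MDP.prodSet_const_aux {X A : Type} [Fintype X] [Fintype A] [DecidableEq X] (M : MDP X A)
    (c : ℝ) :
    ∀ (n : ℕ) (L : Matrix X X ℝ), L ∈ M.prodSet n →
      (L *ᵥ (fun _ => c)) = fun _ => M.γ ^ n * c := by
  intro n
  induction n with
  | zero =>
    intro L hL
    have : L = 1 := hL
    subst this
    simp
  | succ n ih =>
    rintro L ⟨p, Q', hQ', rfl⟩
    rw [← Matrix.mulVec_mulVec, ih Q' hQ']
    funext x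
    simp only [Matrix.mulVec, dotProduct, Matrix.smul_apply, MDP.Pmat,
      Matrix.of_apply, smul_eq_mul]
    rw [← Finset.sum_mul, ← Finset.mul_sum, M.P_sum]
    ring

open Matrix in
theorem MDP.prodSet_abs_aux {X A : Type} [Fintype X] [Fintype A] [DecidableEq X] (M : MDP X A)
    {n : ℕ} {L : Matrix X X ℝ} (hL : L ∈ M.prodSet n) (u : X → ℝ) (x : X) :
    |(L *ᵥ u) x| ≤ M.γ ^ n * ‖u‖ := by
  have hu : ∀ y, |u y| ≤ ‖u‖ := fun y => norm_le_pi_norm u y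
  have h1 := M.prodSet_mono_aux n L hL u (fun _ => ‖u‖) (fun y => (abs_le.1 (hu y)).2) x
  have h2 := M.prodSet_mono_aux n L hL (fun _ => -‖u‖) u (fun y => (abs_le.1 (hu y)).1) x
  rw [M.prodSet_const_aux _ n L hL] at h1 h2
  rw [abs_le]
  constructor <;> linarith

open Matrix in
theorem MDP.summable_aux {X A : Type} [Fintype X] [Fintype A] [DecidableEq X] (M : MDP X A)
    {ℓ c : ℕ} (hℓ : 1 ≤ ℓ) {H : ℕ → Matrix X X ℝ} (hH : ∀ j, H j ∈ M.prodSet (ℓ * j + c))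
    (u : X → ℝ) (x : X) : Summable fun j => (H j *ᵥ u) x := by
  have hg : Summable fun j : ℕ => (M.γ ^ ℓ) ^ j * (M.γ ^ c * ‖u‖) :=
    (summable_geometric_of_lt_one (pow_nonneg M.γ_pos.le _)
      (pow_lt_one₀ M.γ_pos.le M.γ_lt_one (by omega))).mul_right _
  refine Summable.of_norm_bounded hg fun j => ?_
  have := M.prodSet_abs_aux (hH j) u x
  rw [Real.norm_eq_abs]
  calc _ ≤ _ := this
    _ = _ := by rw [pow_add, pow_mul]; ring

open Matrix in
theorem MDP.Tcomp_sub_aux {X A : Type} [Fintype X] [Fintype A] [DecidableEq X] (M : MDP X A)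
    (π : ℤ → X → A) : ∀ (n : ℕ) (k : ℤ), ∃ K ∈ M.prodSet n, ∀ u w : X → ℝ,
      M.Tcomp π n k u - M.Tcomp π n k w = K *ᵥ (u - w) := by
  intro n
  induction n with
  | zero => intro k; exact ⟨1, rfl, fun u w => by simp [MDP.Tcomp]⟩
  | succ n ih =>
    intro k
    obtain ⟨K, hK, h⟩ := ih (k - 1)
    refine ⟨_, ⟨π k, K, hK, rfl⟩, fun u w => ?_⟩
    rw [← Matrix.mulVec_mulVec, ← h, ← M.T_sub_aux]
    rfl

theorem MDP.Tcomp_comm_aux {X A : Type} [Fintype X] [Fintype A] (M : MDP X A)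
    (π : ℤ → X → A) (u : X → ℝ) : ∀ (n : ℕ) (k : ℤ),
      M.Tcomp π n k (M.T (π (k - n)) u) = M.T (π k) (M.Tcomp π n (k - 1) u) := by
  intro n
  induction n with
  | zero => intro k; simp [MDP.Tcomp]
  | succ n ih =>
    intro k
    have := ih (k - 1)
    rw [show k - 1 - (n : ℤ) = k - ((n + 1 : ℕ) : ℤ) by push_cast; ring] at this
    simp only [MDP.Tcomp]
    rw [this]

open Matrix in
theorem MDP.iterate_sub_aux {X : Type} [Fintype X] [DecidableEq X] {F : (X → ℝ) → (X → ℝ)}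
    {K : Matrix X X ℝ} (h : ∀ u w, F u - F w = K *ᵥ (u - w)) (j : ℕ) (u w : X → ℝ) :
    F^[j] u - F^[j] w = (K ^ j) *ᵥ (u - w) := by
  induction j with
  | zero => simp
  | succ n ih =>
    rw [Function.iterate_succ_apply', Function.iterate_succ_apply', h, ih, pow_succ',
      Matrix.mulVec_mulVec]

open Matrix in
theorem MDP.iterate_sum_aux {X : Type} [Fintype X] [DecidableEq X] {F : (X → ℝ) → (X → ℝ)}
    {K : Matrix X X ℝ} (h : ∀ u w, F u - F w = K *ᵥ (u - w)) (N : ℕ) (u : X → ℝ) (x : X) :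
    u x - F^[N] u x = ∑ j ∈ Finset.range N, ((K ^ j) *ᵥ (u - F u)) x := by
  induction N with
  | zero => simp
  | succ n ih =>
    rw [Finset.sum_range_succ, ← ih, ← MDP.iterate_sub_aux h, ← Function.iterate_succ_apply]
    simp

theorem MDP.greedy_le_aux {X A : Type} [Fintype X] [Fintype A] (M : MDP X A)
    {p : X → A} {u : X → ℝ} (h : M.IsGreedyPol p u) (p' : X → A) (x : X) :
    M.T p' u x ≤ M.T p u x := by
  rw [h x]
  exact le_ciSup (f := fun π' : X → A => M.T π' u x) (Set.finite_range _).bddAbove p'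

open Matrix in
theorem MDP.T_mono_aux {X A : Type} [Fintype X] [Fintype A] (M : MDP X A)
    (p : X → A) {u w : X → ℝ} (h : ∀ x, u x ≤ w x) (x : X) : M.T p u x ≤ M.T p w x := by
  classical
  have h1 := congrFun (M.T_sub_aux p w u) x
  have h2 := M.prodSet_mono_aux 1 _ (M.prodSet_one_aux p) u w h x
  rw [Matrix.mulVec_sub] at h1
  simp only [Pi.sub_apply] at h1
  linarith

theorem MDP.vstar_aux {X A : Type} [Fintype X] [Fintype A] [Nonempty A] (M : MDP X A)
    (vpi : (X → A) → X → ℝ) (hvpi : ∀ π : X → A, M.T π (vpi π) = vpi π)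
    (vstar : X → ℝ) (hvstar : ∀ x, vstar x = ⨆ π : X → A, vpi π x) :
    ∃ p : X → A, ∀ x, vstar x ≤ M.T p vstar x := by
  have hex : ∀ x, ∃ q : X → A, vpi q x = vstar x := fun x => by
    obtain ⟨q, hq⟩ := exists_eq_ciSup_of_finite (f := fun π : X → A => vpi π x)
    exact ⟨q, by rw [hvstar, ← hq]⟩
  choose q hq using hex
  refine ⟨fun x => q x x, fun x => ?_⟩
  have h1 : M.T (q x) (vpi (q x)) x ≤ M.T (q x) vstar x := by
    refine M.T_mono_aux _ (fun y => ?_) x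
    rw [hvstar y]
    exact le_ciSup (f := fun π : X → A => vpi π y) (Set.finite_range _).bddAbove (q x)
  rw [hvpi, hq] at h1
  exact h1

/-- Recursion on the residual. -/
theorem MDP.b_step_aux {X A : Type} [Fintype X] [Fintype A] [DecidableEq X]
    (M : MDP X A) (m ℓ : ℕ)
    (v : ℕ → X → ℝ) (π : ℤ → X → A) (err : ℕ → X → ℝ)
    (hgreedy : ∀ k : ℕ, 1 ≤ k → M.IsGreedyPol (π (k : ℤ)) (v (k - 1)))
    (hv : ∀ k : ℕ, 1 ≤ k →
      v k = fun x => (M.Tcomp π ℓ (k : ℤ))^[m] (M.T (π (k : ℤ)) (v (k - 1))) x + err k x)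
    (q : ℕ) :
    ∃ P ∈ M.prodSet 1, ∃ K ∈ M.prodSet ℓ, ∀ x, bres M π ℓ v (q + 1) x ≤
      (P * (1 - K)).mulVec (err (q + 1)) x + (P * K ^ m).mulVec (bres M π ℓ v q) x := by
  obtain ⟨K, hK, hKs⟩ := M.Tcomp_sub_aux π ℓ ((q : ℤ) + 1)
  obtain ⟨L, hL, hLs⟩ := M.Tcomp_sub_aux π ℓ ((q : ℤ) + 1 + 1)
  refine ⟨_, M.prodSet_one_aux (π ((q : ℤ) + 1 + 1)), K, hK, fun x => ?_⟩
  have hg := hgreedy (q + 1 + 1) (by omega)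
  have hvq := hv (q + 1) (by omega)
  simp only [Nat.add_sub_cancel] at hg hvq
  push_cast at hg hvq
  set F := M.Tcomp π ℓ ((q : ℤ) + 1) with hF
  set u := M.T (π ((q : ℤ) + 1)) (v q) with hu
  have hb : bres M π ℓ v q = u - F u := rfl
  have h1 : bres M π ℓ v (q + 1) x ≤
      M.T (π ((q : ℤ) + 1 + 1)) (v (q + 1)) x - M.T (π ((q : ℤ) + 1 + 1)) (F (v (q + 1))) x := by
    have hc := M.Tcomp_comm_aux π (v (q + 1)) ℓ ((q : ℤ) + 1 + 1)
    rw [add_sub_cancel_right, ← hF] at hc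
    rw [← hc]
    have h2 := congrFun (hLs (M.T (π ((q : ℤ) + 1 + 1)) (v (q + 1)))
      (M.T (π ((q : ℤ) + 1 + 1 - ℓ)) (v (q + 1)))) x
    have h3 := M.prodSet_mono_aux _ L hL _ _
      (fun y => M.greedy_le_aux hg (π ((q : ℤ) + 1 + 1 - ℓ)) y) x
    rw [Matrix.mulVec_sub] at h2
    simp only [Pi.sub_apply] at h2
    simp only [bres]
    push_cast
    linarith
  have h2 := congrFun (M.T_sub_aux (π ((q : ℤ) + 1 + 1)) (v (q + 1)) (F (v (q + 1)))) x
  have h3 : v (q + 1) - F (v (q + 1)) =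
      (1 - K).mulVec (err (q + 1)) + (K ^ m).mulVec (bres M π ℓ v q) := by
    rw [hb, ← MDP.iterate_sub_aux hKs, ← Function.iterate_succ_apply,
      Function.iterate_succ_apply', Matrix.sub_mulVec, Matrix.one_mulVec]
    have h4 := hKs (v (q + 1)) (F^[m] u)
    have h5 : v (q + 1) = F^[m] u + err (q + 1) := hvq
    have h6 : v (q + 1) - F^[m] u = err (q + 1) := by rw [h5]; simp
    rw [h6] at h4
    rw [← h4]
    nth_rewrite 1 [h5]
    abel
  rw [h3, Matrix.mulVec_add, Matrix.mulVec_mulVec, Matrix.mulVec_mulVec] at h2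
  simp only [Pi.sub_apply, Pi.add_apply] at h2
  linarith

/-- One-step bound on the distance after `N` sweeps. -/
theorem MDP.u_step_aux {X A : Type} [Fintype X] [Fintype A] [DecidableEq X]
    (M : MDP X A) (vstar : X → ℝ) (p : X → A) (hp : ∀ x, vstar x ≤ M.T p vstar x)
    (v : ℕ → X → ℝ) (π : ℤ → X → A)
    (hgreedy : ∀ k : ℕ, 1 ≤ k → M.IsGreedyPol (π (k : ℤ)) (v (k - 1)))
    (q : ℕ) (x : X) : vstar x - M.T (π ((q : ℤ) + 1)) (v q) x ≤
      (M.γ • M.Pmat p).mulVec (vstar - v q) x := by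
  have hg := hgreedy (q + 1) (by omega)
  simp only [Nat.add_sub_cancel] at hg
  push_cast at hg
  rw [← M.T_sub_aux]
  have := M.greedy_le_aux hg p x
  have := hp x
  simp only [Pi.sub_apply]
  linarith

theorem MDP.d_step_aux {X A : Type} [Fintype X] [Fintype A] [DecidableEq X]
    (M : MDP X A) (vstar : X → ℝ) (p : X → A) (hp : ∀ x, vstar x ≤ M.T p vstar x)
    (m ℓ : ℕ) (v : ℕ → X → ℝ) (π : ℤ → X → A) (err : ℕ → X → ℝ)
    (hgreedy : ∀ k : ℕ, 1 ≤ k → M.IsGreedyPol (π (k : ℤ)) (v (k - 1)))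
    (hv : ∀ k : ℕ, 1 ≤ k →
      v k = fun x => (M.Tcomp π ℓ (k : ℤ))^[m] (M.T (π (k : ℤ)) (v (k - 1))) x + err k x)
    (q : ℕ) :
    ∃ W ∈ M.prodSet 1, ∃ K ∈ M.prodSet ℓ, ∀ x, (vstar - v (q + 1)) x ≤
      (W.mulVec (vstar - v q) + ∑ j ∈ Finset.range m, (K ^ j).mulVec (bres M π ℓ v q)
        - err (q + 1)) x := by
  obtain ⟨K, hK, hKs⟩ := M.Tcomp_sub_aux π ℓ ((q : ℤ) + 1)
  refine ⟨_, M.prodSet_one_aux p, K, hK, fun x => ?_⟩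
  have h1 := M.u_step_aux vstar p hp v π hgreedy q x
  have h2 := MDP.iterate_sum_aux hKs m (M.T (π ((q : ℤ) + 1)) (v q)) x
  have hvq := congrFun (hv (q + 1) (by omega)) x
  simp only [Nat.add_sub_cancel] at hvq
  push_cast at hvq
  have hb : bres M π ℓ v q = M.T (π ((q : ℤ) + 1)) (v q) -
    M.Tcomp π ℓ ((q : ℤ) + 1) (M.T (π ((q : ℤ) + 1)) (v q)) := rfl
  rw [← hb] at h2
  simp only [Pi.sub_apply, Pi.add_apply, Finset.sum_apply]
  linarith

theorem MDP.base_aux {X A : Type} [Fintype X] [Fintype A] [DecidableEq X]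
    (M : MDP X A) (vstar : X → ℝ) (p : X → A) (hp : ∀ x, vstar x ≤ M.T p vstar x)
    (ℓ : ℕ) (hℓ : 1 ≤ ℓ) (v : ℕ → X → ℝ) (π : ℤ → X → A)
    (hgreedy : ∀ k : ℕ, 1 ≤ k → M.IsGreedyPol (π (k : ℤ)) (v (k - 1)))
    (q : ℕ) (w : X → ℝ) (hw : M.Tcomp π ℓ ((q : ℤ) + 1) w = w) :
    ∃ W ∈ M.prodSet 1, ∃ K ∈ M.prodSet ℓ, ∀ x, vstar x - w x ≤
      W.mulVec (vstar - v q) x + ∑' j : ℕ, (K ^ j).mulVec (bres M π ℓ v q) x := by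
  obtain ⟨K, hK, hKs⟩ := M.Tcomp_sub_aux π ℓ ((q : ℤ) + 1)
  refine ⟨_, M.prodSet_one_aux p, K, hK, fun x => ?_⟩
  have h1 := M.u_step_aux vstar p hp v π hgreedy q x
  set u := M.T (π ((q : ℤ) + 1)) (v q) with hu
  have hKp : ∀ j, K ^ j ∈ M.prodSet (ℓ * j + 0) := fun j => M.prodSet_pow_aux hK j
  have hs := (M.summable_aux hℓ hKp (bres M π ℓ v q) x).hasSum.tendsto_sum_nat
  have hz := (M.summable_aux hℓ hKp (u - w) x).tendsto_atTop_zero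
  have he : ∀ N : ℕ, u x - w x - (Matrix.mulVec (K ^ N) (u - w)) x =
      ∑ j ∈ Finset.range N, (K ^ j).mulVec (bres M π ℓ v q) x := fun N => by
    have h2 := MDP.iterate_sum_aux hKs N u x
    have h3 := congrFun (MDP.iterate_sub_aux hKs N u w) x
    rw [Function.iterate_fixed hw] at h3
    have hb : bres M π ℓ v q = u - M.Tcomp π ℓ ((q : ℤ) + 1) u := rfl
    rw [hb, ← h2, ← h3]
    simp only [Pi.sub_apply]
    ring
  have hz2 := hz.const_sub (u x - w x)
  rw [sub_zero] at hz2
  have := tendsto_nhds_unique (hz2.congr he) hs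
  linarith

theorem MDP.main_aux {X A : Type} [Fintype X] [Fintype A] [DecidableEq X]
    (M : MDP X A) (vstar : X → ℝ) (p : X → A) (hp : ∀ x, vstar x ≤ M.T p vstar x)
    (m ℓ : ℕ) (hℓ : 1 ≤ ℓ) (v : ℕ → X → ℝ) (π : ℤ → X → A) (err : ℕ → X → ℝ)
    (hgreedy : ∀ k : ℕ, 1 ≤ k → M.IsGreedyPol (π (k : ℤ)) (v (k - 1)))
    (hv : ∀ k : ℕ, 1 ≤ k →
      v k = fun x => (M.Tcomp π ℓ (k : ℤ))^[m] (M.T (π (k : ℤ)) (v (k - 1))) x + err k x)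
    (k : ℕ) (w : X → ℝ) (hw : M.Tcomp π ℓ (k : ℤ) w = w) (n : ℕ) :
    ∀ q : ℕ, q + n + 1 = k →
    ∃ (G : ℕ → Matrix X X ℝ) (R : ℕ → ℕ → Matrix X X ℝ) (S : ℕ → Matrix X X ℝ)
      (H : ℕ → Matrix X X ℝ) (W : Matrix X X ℝ),
      (∀ i ∈ Finset.Icc 1 n,
        G i ∈ M.prodSet i ∧ (∀ j : ℕ, R i j ∈ M.prodSet (ℓ * j + i)) ∧ S i ∈ M.prodSet ℓ) ∧
      (∀ i : ℕ, H i ∈ M.prodSet (ℓ * i + n)) ∧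
      W ∈ M.prodSet (n + 1) ∧
      ∀ x, vstar x - w x ≤
        (∑ i ∈ Finset.Icc 1 n,
          ((∑' j : ℕ, (R i j * ((1 : Matrix X X ℝ) - S i)).mulVec (err (k - i)) x)
            - (G i).mulVec (err (k - i)) x))
        + ((∑' i : ℕ, (H i).mulVec (bres M π ℓ v q) x)
            + W.mulVec (vstar - v q) x) := by
  induction n with
  | zero =>
    intro q hq
    subst hq
    push_cast at hw
    obtain ⟨W, hW, K, hK, h⟩ := M.base_aux vstar p hp ℓ hℓ v π hgreedy q w (by simpa using hw)
    refine ⟨fun _ => 1, fun _ _ => 1, fun _ => 1, fun j => K ^ j, W, by simp,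
      fun i => M.prodSet_pow_aux hK i, hW, fun x => ?_⟩
    have := h x
    simp only [Finset.Icc_eq_empty_of_lt zero_lt_one, Finset.sum_empty]
    linarith
  | succ n ih =>
    intro q hq
    obtain ⟨G, R, S, H, W, hGRS, hH, hW, hle⟩ := ih (q + 1) (by omega)
    obtain ⟨P, hP, K, hK, hb⟩ := M.b_step_aux m ℓ v π err hgreedy hv q
    obtain ⟨V, hV, L, hL, hd⟩ := M.d_step_aux vstar p hp m ℓ v π err hgreedy hv q
    have hH' : ∀ j, (if j < m then W * L ^ j else H (j - m) * (P * K ^ m)) ∈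
        M.prodSet (ℓ * j + (n + 1)) := fun j => by
      split_ifs with hj
      · have := M.prodSet_mul_aux (M.prodSet_pow_aux hL j) _ _ hW
        rwa [add_comm] at this
      · have := M.prodSet_mul_aux (M.prodSet_mul_aux (M.prodSet_pow_aux hK m) _ _ hP) _ _
          (hH (j - m))
        obtain ⟨t, rfl⟩ := Nat.exists_eq_add_of_le (not_lt.1 hj)
        rw [Nat.add_sub_cancel_left] at this ⊢
        rwa [show ℓ * (m + t) + (n + 1) = ℓ * t + n + (1 + ℓ * m) by ring]
    have hR' : ∀ j, H j * P ∈ M.prodSet (ℓ * j + (n + 1)) := fun j =>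
      M.prodSet_mul_aux hP _ _ (hH j)
    refine ⟨fun i => if i = n + 1 then W else G i, fun i j => if i = n + 1 then H j * P else R i j,
      fun i => if i = n + 1 then K else S i,
      fun j => if j < m then W * L ^ j else H (j - m) * (P * K ^ m), W * V, ?_, hH',
      M.prodSet_mul_aux hV _ _ hW, fun x => ?_⟩
    · intro i hi
      by_cases h : i = n + 1
      · subst h
        simp only [if_true]
        exact ⟨hW, hR', hK⟩
      · simp only [h, if_false]
        exact hGRS i (by simp only [Finset.mem_Icc] at hi ⊢; omega)
    · have hx := hle x
      rw [Finset.sum_Icc_succ_top (by omega)]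
      simp only [if_true]
      have hki : k - (n + 1) = q + 1 := by omega
      rw [hki]
      have hsum : ∑ i ∈ Finset.Icc 1 n,
          ((∑' j : ℕ, ((if i = n + 1 then H j * P else R i j) *
            ((1 : Matrix X X ℝ) - (if i = n + 1 then K else S i))).mulVec (err (k - i)) x)
            - (if i = n + 1 then W else G i).mulVec (err (k - i)) x) =
          ∑ i ∈ Finset.Icc 1 n,
          ((∑' j : ℕ, (R i j * ((1 : Matrix X X ℝ) - S i)).mulVec (err (k - i)) x)
            - (G i).mulVec (err (k - i)) x) := by
        refine Finset.sum_congr rfl fun i hi => ?_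
        have : i ≠ n + 1 := by simp only [Finset.mem_Icc] at hi; omega
        simp only [this, if_false]
      rw [hsum]
      -- the distance term
      have hWd := M.prodSet_mono_aux _ W hW _ _ hd x
      rw [Matrix.mulVec_sub W (_ + _) (err (q + 1)), Matrix.mulVec_add, Matrix.mulVec_sum,
        Matrix.mulVec_mulVec] at hWd
      simp only [Pi.sub_apply, Pi.add_apply, Finset.sum_apply, Matrix.mulVec_mulVec] at hWd
      -- the residual term
      have hsA : Summable fun j => ((H j * P) * (1 - K)).mulVec (err (q + 1)) x := by
        simpa only [Matrix.mulVec_mulVec] using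
          M.summable_aux hℓ hR' ((1 - K).mulVec (err (q + 1))) x
      have hsH' := M.summable_aux hℓ hH' (bres M π ℓ v q) x
      have hsplit := hsH'.sum_add_tsum_nat_add m
      have hsB := (summable_nat_add_iff m).2 hsH'
      have e1 : ∑ j ∈ Finset.range m, ((if j < m then W * L ^ j else H (j - m) * (P * K ^ m))).mulVec
          (bres M π ℓ v q) x = ∑ j ∈ Finset.range m, (W * L ^ j).mulVec (bres M π ℓ v q) x := by
        refine Finset.sum_congr rfl fun j hj => ?_
        rw [if_pos (Finset.mem_range.1 hj)]
      have e2 : (fun j => ((if j + m < m then W * L ^ (j + m) else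
          H (j + m - m) * (P * K ^ m))).mulVec (bres M π ℓ v q) x) =
          fun j => (H j * (P * K ^ m)).mulVec (bres M π ℓ v q) x := by
        funext j
        rw [if_neg (by omega), Nat.add_sub_cancel]
      rw [e2] at hsB hsplit
      rw [e1] at hsplit
      have hHb : ∑' j, (H j).mulVec (bres M π ℓ v (q + 1)) x ≤
          ∑' j, (((H j * P) * (1 - K)).mulVec (err (q + 1)) x +
            (H j * (P * K ^ m)).mulVec (bres M π ℓ v q) x) := by
        refine Summable.tsum_le_tsum (fun j => ?_) (M.summable_aux hℓ hH _ x) (hsA.add hsB)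
        have := M.prodSet_mono_aux _ (H j) (hH j) _
          ((P * (1 - K)).mulVec (err (q + 1)) + (P * K ^ m).mulVec (bres M π ℓ v q)) hb x
        rw [Matrix.mulVec_add, Matrix.mulVec_mulVec, Matrix.mulVec_mulVec,
          ← Matrix.mul_assoc (H j) P (1 - K)] at this
        exact this
      rw [hsA.tsum_add hsB] at hHb
      linarith

/-- Loss bound (Lemma 4 of the paper), in Γ-notation. -/
theorem mpi_loss_bound
    {X A : Type} [Fintype X] [Fintype A] [Nonempty X] [Nonempty A] [DecidableEq X]
    (M : MDP X A)
    (vpi : (X → A) → X → ℝ) (hvpi : ∀ π : X → A, M.T π (vpi π) = vpi π)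
    (vstar : X → ℝ) (hvstar : ∀ x, vstar x = ⨆ π : X → A, vpi π x)
    (m ℓ : ℕ) (hℓ : 1 ≤ ℓ)
    (v : ℕ → X → ℝ) (π : ℤ → X → A) (err : ℕ → X → ℝ)
    (herr0 : err 0 = fun _ => 0)
    (hgreedy : ∀ k : ℕ, 1 ≤ k → M.IsGreedyPol (π (k : ℤ)) (v (k - 1)))
    (hv : ∀ k : ℕ, 1 ≤ k →
      v k = fun x => (M.Tcomp π ℓ (k : ℤ))^[m] (M.T (π (k : ℤ)) (v (k - 1))) x + err k x)
    (vns : ℕ → X → ℝ) (hvns : ∀ k : ℕ, 1 ≤ k → M.Tcomp π ℓ (k : ℤ) (vns k) = vns k)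
    (k : ℕ) (hk : 1 ≤ k) :
    ∃ (G : ℕ → Matrix X X ℝ) (R S : ℕ → ℕ → Matrix X X ℝ)
      (H : ℕ → Matrix X X ℝ) (W : Matrix X X ℝ),
      (∀ i ∈ Finset.Icc 1 (k - 1),
        G i ∈ M.Gamma i ∧ ∀ j : ℕ, R i j ∈ M.Gamma (i + ℓ * j) ∧ S i j ∈ M.Gamma ℓ) ∧
      (∀ i : ℕ, H i ∈ M.Gamma (ℓ * i + k - 1)) ∧
      W ∈ M.Gamma k ∧
      (∀ i ∈ Finset.Icc 1 (k - 1), ∀ x,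
        Summable fun j : ℕ =>
          (R i j * ((1 : Matrix X X ℝ) - S i j)).mulVec (err (k - i)) x) ∧
      (∀ x, Summable fun i : ℕ => (H i).mulVec (bres M π ℓ v 0) x) ∧
      ∀ x, vstar x - vns k x ≤
        (∑ i ∈ Finset.Icc 1 (k - 1),
          ((∑' j : ℕ, (R i j * ((1 : Matrix X X ℝ) - S i j)).mulVec (err (k - i)) x)
            - (G i).mulVec (err (k - i)) x))
        + ((∑' i : ℕ, (H i).mulVec (bres M π ℓ v 0) x)
            + W.mulVec (dres vstar v err 0) x) := by
  obtain ⟨p, hp⟩ := M.vstar_aux vpi hvpi vstar hvstar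
  obtain ⟨G, R, S, H, W, hGRS, hH, hW, hle⟩ := M.main_aux vstar p hp m ℓ hℓ v π err hgreedy hv
    k (vns k) (hvns k hk) (k - 1) 0 (by omega)
  have hsub : ∀ n, M.prodSet n ⊆ M.Gamma n := fun n => subset_convexHull ℝ _
  refine ⟨G, R, fun i _ => S i, H, W, ?_, ?_, ?_, ?_, ?_, ?_⟩
  · intro i hi
    obtain ⟨h1, h2, h3⟩ := hGRS i hi
    refine ⟨hsub _ h1, fun j => ⟨hsub _ ?_, hsub _ h3⟩⟩
    rw [add_comm]
    exact h2 j
  · intro i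
    have := hsub _ (hH i)
    rwa [← Nat.add_sub_assoc hk] at this
  · have := hsub _ hW
    rwa [Nat.sub_add_cancel hk] at this
  · intro i hi x
    simpa only [Matrix.mulVec_mulVec] using
      M.summable_aux hℓ (hGRS i hi).2.1 ((1 - S i).mulVec (err (k - i))) x
  · exact fun x => M.summable_aux hℓ hH _ x
  · intro x
    have hd : dres vstar v err 0 = vstar - v 0 := by
      funext y
      simp [dres, herr0]
    rw [hd]
    exact hle x
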